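/- (Derivative bound for the value function.) Let K ∈ 𝕂 and let E be any tuple of real k×d matrices with ‖E‖₂ = 1. Define (P^K)'[E] = ∑_{t=0}^∞ L^t(Eᵀ L^K + (L^K)ᵀ E), where L is the operator with components L_i(V) = Γ_iᵀ E_i(V) Γ_i. Then, with ξ = (1/Λ_min(Q))·((1 + ‖B‖²_max)·C(K)/μ + ‖R‖_max) − 1, one has (P^K)'[E]_i ⪯ ξ·P^K_i for every i (Loewner order), and hence max_i ‖(P^K)'[E]_i‖ ≤ ξ·max_i ‖P^K_i‖. -/

import Mathlib

open Matrix Filter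
open scoped Kronecker Topology

namespace MJLS

noncomputable section

attribute [local instance] Classical.propDecidable

/-- Closed-loop matrices `Γ i = A i - B i * K i`. -/
def Gam {d k N : ℕ} (A : Fin N → Matrix (Fin d) (Fin d) ℝ)
    (B : Fin N → Matrix (Fin d) (Fin k) ℝ)
    (K : Fin N → Matrix (Fin k) (Fin d) ℝ) : Fin N → Matrix (Fin d) (Fin d) ℝ :=
  fun i => A i - B i * K i

/-- The operator `E_i(V) = ∑ j, p i j • V j`. -/
def opE {d N : ℕ} (Pr : Matrix (Fin N) (Fin N) ℝ)
    (V : Fin N → Matrix (Fin d) (Fin d) ℝ) : Fin N → Matrix (Fin d) (Fin d) ℝ :=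
  fun i => ∑ j, Pr i j • V j

/-- The matrix `𝒜 = diag(Γᵀ ⊗ Γᵀ) (P ⊗ I)`. -/
def calA {d N : ℕ} (Pr : Matrix (Fin N) (Fin N) ℝ)
    (Γ : Fin N → Matrix (Fin d) (Fin d) ℝ) :
    Matrix (Fin N × Fin d × Fin d) (Fin N × Fin d × Fin d) ℝ :=
  (Matrix.reindex (Equiv.prodComm (Fin d × Fin d) (Fin N))
      (Equiv.prodComm (Fin d × Fin d) (Fin N))
      (Matrix.blockDiagonal fun i => (Γ i)ᵀ ⊗ₖ (Γ i)ᵀ)) *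
    (Pr ⊗ₖ (1 : Matrix (Fin d × Fin d) (Fin d × Fin d) ℝ))

/-- `K` is mean-square stabilizing: the spectral radius of `𝒜` is less than `1`. -/
def MSS {d k N : ℕ} (Pr : Matrix (Fin N) (Fin N) ℝ)
    (A : Fin N → Matrix (Fin d) (Fin d) ℝ) (B : Fin N → Matrix (Fin d) (Fin k) ℝ)
    (K : Fin N → Matrix (Fin k) (Fin d) ℝ) : Prop :=
  spectralRadius ℂ ((calA Pr (Gam A B K)).map (algebraMap ℝ ℂ)) < 1

/-- `P` solves the coupled Lyapunov equations for the policy `K`. -/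
def IsLyap {d k N : ℕ} (Pr : Matrix (Fin N) (Fin N) ℝ)
    (A : Fin N → Matrix (Fin d) (Fin d) ℝ) (B : Fin N → Matrix (Fin d) (Fin k) ℝ)
    (Q : Fin N → Matrix (Fin d) (Fin d) ℝ) (R : Fin N → Matrix (Fin k) (Fin k) ℝ)
    (K : Fin N → Matrix (Fin k) (Fin d) ℝ)
    (P : Fin N → Matrix (Fin d) (Fin d) ℝ) : Prop :=
  ∀ i, P i = Q i + (K i)ᵀ * R i * K i + (Gam A B K i)ᵀ * opE Pr P i * Gam A B K i

/-- `P^K`, the (for mean-square stabilizing `K`, unique) solution of the coupled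
Lyapunov equations. -/
def PK {d k N : ℕ} (Pr : Matrix (Fin N) (Fin N) ℝ)
    (A : Fin N → Matrix (Fin d) (Fin d) ℝ) (B : Fin N → Matrix (Fin d) (Fin k) ℝ)
    (Q : Fin N → Matrix (Fin d) (Fin d) ℝ) (R : Fin N → Matrix (Fin k) (Fin k) ℝ)
    (K : Fin N → Matrix (Fin k) (Fin d) ℝ) : Fin N → Matrix (Fin d) (Fin d) ℝ :=
  if h : ∃ P, IsLyap Pr A B Q R K P then h.choose else 0

/-- The LQR cost `C(K) = ∑ i, π i * tr(P^K_i Sg)`. -/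
def cost {d k N : ℕ} (Pr : Matrix (Fin N) (Fin N) ℝ)
    (A : Fin N → Matrix (Fin d) (Fin d) ℝ) (B : Fin N → Matrix (Fin d) (Fin k) ℝ)
    (Q : Fin N → Matrix (Fin d) (Fin d) ℝ) (R : Fin N → Matrix (Fin k) (Fin k) ℝ)
    (piv : Fin N → ℝ) (Sg : Matrix (Fin d) (Fin d) ℝ)
    (K : Fin N → Matrix (Fin k) (Fin d) ℝ) : ℝ :=
  ∑ i, piv i * (PK Pr A B Q R K i * Sg).trace

/-- The operator `T_j(V) = ∑ i, p i j • (Γ i * V i * Γ iᵀ)`. -/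
def opT {d N : ℕ} (Pr : Matrix (Fin N) (Fin N) ℝ)
    (Γ : Fin N → Matrix (Fin d) (Fin d) ℝ)
    (V : Fin N → Matrix (Fin d) (Fin d) ℝ) : Fin N → Matrix (Fin d) (Fin d) ℝ :=
  fun j => ∑ i, Pr i j • (Γ i * V i * (Γ i)ᵀ)

/-- `𝐗^K = ∑_{t=0}^∞ T^t(X(0))` with `X_i(0) = π i • Sg`. -/
def XK {d N : ℕ} (Pr : Matrix (Fin N) (Fin N) ℝ) (piv : Fin N → ℝ)
    (Sg : Matrix (Fin d) (Fin d) ℝ) (Γ : Fin N → Matrix (Fin d) (Fin d) ℝ) :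
    Fin N → Matrix (Fin d) (Fin d) ℝ :=
  ∑' t : ℕ, (opT Pr Γ)^[t] (fun i => piv i • Sg)

/-- `L^K_i = (R i + B iᵀ E_i(P^K) B i) K i - B iᵀ E_i(P^K) A i`. -/
def LK {d k N : ℕ} (Pr : Matrix (Fin N) (Fin N) ℝ)
    (A : Fin N → Matrix (Fin d) (Fin d) ℝ) (B : Fin N → Matrix (Fin d) (Fin k) ℝ)
    (Q : Fin N → Matrix (Fin d) (Fin d) ℝ) (R : Fin N → Matrix (Fin k) (Fin k) ℝ)
    (K : Fin N → Matrix (Fin k) (Fin d) ℝ) : Fin N → Matrix (Fin k) (Fin d) ℝ :=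
  fun i => (R i + (B i)ᵀ * opE Pr (PK Pr A B Q R K) i * B i) * K i
    - (B i)ᵀ * opE Pr (PK Pr A B Q R K) i * A i

/-- The operator `L_i(V) = Γ iᵀ E_i(V) Γ i`. -/
def opL {d N : ℕ} (Pr : Matrix (Fin N) (Fin N) ℝ)
    (Γ : Fin N → Matrix (Fin d) (Fin d) ℝ)
    (V : Fin N → Matrix (Fin d) (Fin d) ℝ) : Fin N → Matrix (Fin d) (Fin d) ℝ :=
  fun i => (Γ i)ᵀ * opE Pr V i * Γ i

/-- `(P^K)'[E] = ∑_{t=0}^∞ L^t(Eᵀ L^K + (L^K)ᵀ E)`. -/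
def PKd {d k N : ℕ} (Pr : Matrix (Fin N) (Fin N) ℝ)
    (Γ : Fin N → Matrix (Fin d) (Fin d) ℝ)
    (Lk E : Fin N → Matrix (Fin k) (Fin d) ℝ) : Fin N → Matrix (Fin d) (Fin d) ℝ :=
  ∑' t : ℕ, (opL Pr Γ)^[t] (fun i => (E i)ᵀ * Lk i + (Lk i)ᵀ * E i)

/-- `‖V‖₂² = ∑ i, tr(V iᵀ V i)`. -/
def norm2sq {a b N : ℕ} (V : Fin N → Matrix (Fin a) (Fin b) ℝ) : ℝ :=
  ∑ i, ((V i)ᵀ * V i).trace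

/-- The inner product `⟨V, S⟩ = ∑ i, tr(V iᵀ S i)`. -/
def ip {a b N : ℕ} (V S : Fin N → Matrix (Fin a) (Fin b) ℝ) : ℝ :=
  ∑ i, ((V i)ᵀ * S i).trace

/-- The spectral norm (maximal singular value) of a matrix. -/
def specNorm {a b : ℕ} (M : Matrix (Fin a) (Fin b) ℝ) : ℝ :=
  ⨆ x : {x : EuclideanSpace ℝ (Fin b) // ‖x‖ ≤ 1}, ‖Matrix.toEuclideanLin M x.1‖

/-- The minimal singular value of a square matrix. -/
def sigmaMin {a : ℕ} (M : Matrix (Fin a) (Fin a) ℝ) : ℝ :=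
  ⨅ x : {x : EuclideanSpace ℝ (Fin a) // ‖x‖ = 1}, ‖Matrix.toEuclideanLin M x.1‖

/-- `‖V‖_max = max_i ‖V i‖` (spectral norms). -/
def maxNorm {a b N : ℕ} (V : Fin N → Matrix (Fin a) (Fin b) ℝ) : ℝ :=
  ⨆ i, specNorm (V i)

/-- `Λ_min(V) = min_i σ_min(V i)`. -/
def lamMin {a N : ℕ} (V : Fin N → Matrix (Fin a) (Fin a) ℝ) : ℝ :=
  ⨅ i, sigmaMin (V i)

/-- `μ = (min_i π i) · σ_min(Sg)`. -/
def mu {d N : ℕ} (piv : Fin N → ℝ) (Sg : Matrix (Fin d) (Fin d) ℝ) : ℝ :=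
  (⨅ i, piv i) * sigmaMin Sg

/-- `ξ(α) = (1/Λ_min(Q))·((1 + ‖B‖²_max)·α/μ + ‖R‖_max) − 1`. -/
def xi {d k N : ℕ} (B : Fin N → Matrix (Fin d) (Fin k) ℝ)
    (R : Fin N → Matrix (Fin k) (Fin k) ℝ) (Q : Fin N → Matrix (Fin d) (Fin d) ℝ)
    (piv : Fin N → ℝ) (Sg : Matrix (Fin d) (Fin d) ℝ) (α : ℝ) : ℝ :=
  (1 / lamMin Q) * ((1 + maxNorm B ^ 2) * α / mu piv Sg + maxNorm R) - 1

/-- The smoothness constant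
`L(α) = 2·(‖R‖_max + ‖B‖²_max·(1 + 2ξ(α)/‖B‖_max)·α/μ)·α/Λ_min(Q)`. -/
def Lsm {d k N : ℕ} (B : Fin N → Matrix (Fin d) (Fin k) ℝ)
    (R : Fin N → Matrix (Fin k) (Fin k) ℝ) (Q : Fin N → Matrix (Fin d) (Fin d) ℝ)
    (piv : Fin N → ℝ) (Sg : Matrix (Fin d) (Fin d) ℝ) (α : ℝ) : ℝ :=
  2 * (maxNorm R + maxNorm B ^ 2 * (1 + 2 * xi B R Q piv Sg α / maxNorm B)
      * α / mu piv Sg) * α / lamMin Q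

end

/-! ### Linear algebra helpers -/

lemma norm_lin_sq {a b : ℕ} (M : Matrix (Fin a) (Fin b) ℝ) (x : EuclideanSpace ℝ (Fin b)) :
    ‖Matrix.toEuclideanLin M x‖ ^ 2 = (M *ᵥ x.ofLp) ⬝ᵥ (M *ᵥ x.ofLp) := by
  rw [EuclideanSpace.real_norm_sq_eq]
  simp [dotProduct, Matrix.toLpLin_apply, sq]

lemma norm_vec_sq {b : ℕ} (x : EuclideanSpace ℝ (Fin b)) :
    ‖x‖ ^ 2 = x.ofLp ⬝ᵥ x.ofLp := by
  rw [EuclideanSpace.real_norm_sq_eq]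
  simp [dotProduct, sq]

lemma bdd_spec {a b : ℕ} (M : Matrix (Fin a) (Fin b) ℝ) :
    BddAbove (Set.range fun x : {x : EuclideanSpace ℝ (Fin b) // ‖x‖ ≤ 1} =>
      ‖Matrix.toEuclideanLin M x.1‖) := by
  refine ⟨‖LinearMap.toContinuousLinearMap (Matrix.toEuclideanLin M)‖, ?_⟩
  rintro _ ⟨x, rfl⟩
  have := (LinearMap.toContinuousLinearMap (Matrix.toEuclideanLin M)).le_opNorm x.1
  simp only [LinearMap.coe_toContinuousLinearMap'] at this
  exact this.trans (mul_le_of_le_one_right (norm_nonneg _) x.2)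

lemma specNorm_nonneg {a b : ℕ} (M : Matrix (Fin a) (Fin b) ℝ) : 0 ≤ specNorm M :=
  Real.iSup_nonneg fun _ => norm_nonneg _

lemma le_specNorm {a b : ℕ} (M : Matrix (Fin a) (Fin b) ℝ) (x : EuclideanSpace ℝ (Fin b)) :
    ‖Matrix.toEuclideanLin M x‖ ≤ specNorm M * ‖x‖ := by
  by_cases hx : ‖x‖ = 0
  · rw [norm_eq_zero] at hx; simp [hx]
  have h := le_ciSup (bdd_spec M) ⟨(‖x‖⁻¹) • x, by
    rw [norm_smul]; simp [inv_mul_cancel₀ hx]⟩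
  simp only [map_smul, norm_smul, norm_inv, norm_norm] at h
  change _ ≤ specNorm M at h
  rwa [inv_mul_le_iff₀ (lt_of_le_of_ne (norm_nonneg x) (Ne.symm hx)), mul_comm] at h

lemma specNorm_le {a b : ℕ} (M : Matrix (Fin a) (Fin b) ℝ) (c : ℝ) (hc : 0 ≤ c)
    (h : ∀ x, ‖Matrix.toEuclideanLin M x‖ ≤ c * ‖x‖) : specNorm M ≤ c :=
  Real.iSup_le (fun x => (h x.1).trans (mul_le_of_le_one_right hc x.2)) hc

lemma sigmaMin_le {a : ℕ} (M : Matrix (Fin a) (Fin a) ℝ) (x : EuclideanSpace ℝ (Fin a))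
    (hx : ‖x‖ = 1) : sigmaMin M ≤ ‖Matrix.toEuclideanLin M x‖ :=
  ciInf_le (f := fun x : {x : EuclideanSpace ℝ (Fin a) // ‖x‖ = 1} =>
    ‖Matrix.toEuclideanLin M x.1‖) ⟨0, by rintro _ ⟨x, rfl⟩; exact norm_nonneg _⟩ ⟨x, hx⟩

lemma sigmaMin_pos {a : ℕ} (ha : 0 < a) (M : Matrix (Fin a) (Fin a) ℝ) (hM : M.PosDef) :
    0 < sigmaMin M := by
  have : Nonempty (Fin a) := ⟨⟨0, ha⟩⟩
  have hne : (Metric.sphere (0 : EuclideanSpace ℝ (Fin a)) 1).Nonempty :=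
    NormedSpace.sphere_nonempty.2 zero_le_one
  have hcont : Continuous fun x => ‖Matrix.toEuclideanLin M x‖ :=
    (LinearMap.continuous_of_finiteDimensional _).norm
  obtain ⟨x, hx, hmin⟩ := (isCompact_sphere (0 : EuclideanSpace ℝ (Fin a)) 1).exists_isMinOn hne
    hcont.continuousOn
  have hx1 : ‖x‖ = 1 := by simpa using hx
  have : Nonempty {x : EuclideanSpace ℝ (Fin a) // ‖x‖ = 1} := ⟨⟨x, hx1⟩⟩
  have hpos : 0 < ‖Matrix.toEuclideanLin M x‖ := by
    rw [norm_pos_iff]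
    intro h0
    have hxne : x.ofLp ≠ 0 := by
      intro h
      have := norm_vec_sq x
      rw [hx1, h] at this
      simp at this
    have h1 := hM.dotProduct_mulVec_pos hxne
    have h2 := norm_lin_sq M x
    rw [h0] at h2
    have h3 : M *ᵥ x.ofLp = 0 := by
      apply dotProduct_self_eq_zero.1
      rw [← h2]; simp
    rw [h3] at h1
    simp at h1
  refine hpos.trans_le (le_ciInf fun y => hmin ?_)
  simpa using y.2

lemma psd_sub_sigmaMin {a : ℕ} (M : Matrix (Fin a) (Fin a) ℝ) (hM : M.PosSemidef) (s : ℝ)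
    (hs : s ≤ sigmaMin M) : (M - s • (1 : Matrix (Fin a) (Fin a) ℝ)).PosSemidef := by
  have hH : (M - s • (1 : Matrix (Fin a) (Fin a) ℝ)).IsHermitian := by
    have := hM.isHermitian
    unfold Matrix.IsHermitian at *
    rw [conjTranspose_eq_transpose_of_trivial] at *
    simp [this]
  rw [hH.posSemidef_iff_eigenvalues_nonneg]
  intro j
  have hv := hH.mulVec_eigenvectorBasis j
  have hn : ‖hH.eigenvectorBasis j‖ = 1 := hH.eigenvectorBasis.orthonormal.1 j
  set v := hH.eigenvectorBasis j
  set m := hH.eigenvalues j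
  have hMv : M *ᵥ v.ofLp = (m + s) • v.ofLp := by
    rw [sub_mulVec, smul_mulVec, one_mulVec] at hv
    rw [add_smul, ← hv]; simp
  have hvv : v.ofLp ⬝ᵥ v.ofLp = 1 := by rw [← norm_vec_sq, hn]; norm_num
  have h1 : 0 ≤ m + s := by
    have := hM.dotProduct_mulVec_nonneg v.ofLp
    rw [hMv] at this
    simpa [hvv] using this
  have h2 := hs.trans (sigmaMin_le M v hn)
  have h3 : ‖Matrix.toEuclideanLin M v‖ = m + s := by
    have := norm_lin_sq M v
    rw [hMv] at this
    simp only [smul_dotProduct, dotProduct_smul, hvv, smul_eq_mul, mul_one] at this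
    nlinarith [norm_nonneg (Matrix.toEuclideanLin M v), abs_of_nonneg h1,
      abs_of_nonneg (norm_nonneg (Matrix.toEuclideanLin M v)),
      sq_eq_sq₀ (norm_nonneg (Matrix.toEuclideanLin M v)) h1]
  show 0 ≤ m
  linarith

lemma spec_sub_psd {a : ℕ} (M : Matrix (Fin a) (Fin a) ℝ) (hM : M.IsHermitian) (s : ℝ)
    (hs : specNorm M ≤ s) : (s • (1 : Matrix (Fin a) (Fin a) ℝ) - M).PosSemidef := by
  refine .of_dotProduct_mulVec_nonneg ?_ fun x => ?_
  · unfold Matrix.IsHermitian at *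
    rw [conjTranspose_eq_transpose_of_trivial] at *
    simp [hM]
  · have h1 := le_specNorm M (WithLp.toLp 2 x)
    have h2 := real_inner_le_norm (WithLp.toLp 2 x) (Matrix.toEuclideanLin M (WithLp.toLp 2 x))
    have h3 := norm_vec_sq (WithLp.toLp 2 x)
    have h4 : inner ℝ (WithLp.toLp 2 x) (Matrix.toEuclideanLin M (WithLp.toLp 2 x))
      = x ⬝ᵥ M *ᵥ x := by
      simp [EuclideanSpace.inner_eq_star_dotProduct, Matrix.toLpLin_apply, dotProduct_comm]
    rw [h4] at h2
    simp only [sub_mulVec, smul_mulVec, one_mulVec, star_trivial, dotProduct_sub, dotProduct_smul,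
      smul_eq_mul]
    simp only at h3
    rw [← h3]
    have h5 := norm_nonneg (WithLp.toLp 2 x)
    nlinarith [mul_le_mul_of_nonneg_right hs (sq_nonneg ‖WithLp.toLp 2 x‖)]

lemma spec_sq_sub_psd {a b : ℕ} (M : Matrix (Fin a) (Fin b) ℝ) (s : ℝ)
    (hs : specNorm M ≤ s) : (s ^ 2 • (1 : Matrix (Fin b) (Fin b) ℝ) - Mᵀ * M).PosSemidef := by
  refine .of_dotProduct_mulVec_nonneg ?_ fun x => ?_
  · unfold Matrix.IsHermitian
    simp [conjTranspose_eq_transpose_of_trivial, transpose_mul]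
  · have h1 := (le_specNorm M (WithLp.toLp 2 x)).trans
      (mul_le_mul_of_nonneg_right hs (norm_nonneg _))
    have h2 := pow_le_pow_left₀ (norm_nonneg _) h1 2
    rw [mul_pow, norm_lin_sq, norm_vec_sq] at h2
    simp only [sub_mulVec, smul_mulVec, one_mulVec, star_trivial, dotProduct_sub, dotProduct_smul,
      smul_eq_mul, ← mulVec_mulVec]
    rw [dotProduct_mulVec x, vecMul_transpose]
    linarith

lemma frob_sub_psd {a b : ℕ} (M : Matrix (Fin a) (Fin b) ℝ) :
    ((Mᵀ * M).trace • (1 : Matrix (Fin b) (Fin b) ℝ) - Mᵀ * M).PosSemidef := by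
  refine .of_dotProduct_mulVec_nonneg ?_ fun x => ?_
  · unfold Matrix.IsHermitian
    simp [conjTranspose_eq_transpose_of_trivial, transpose_mul]
  · simp only [sub_mulVec, smul_mulVec, one_mulVec, star_trivial, dotProduct_sub, dotProduct_smul,
      smul_eq_mul, ← mulVec_mulVec]
    rw [dotProduct_mulVec x, vecMul_transpose, sub_nonneg]
    have h : (Mᵀ * M).trace = ∑ i, ∑ j, M i j ^ 2 := by
      simp only [trace, diag, mul_apply, transpose_apply, ← sq]
      rw [Finset.sum_comm]
    rw [h, Finset.sum_mul]
    refine Finset.sum_le_sum fun i _ => ?_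
    have := Finset.sum_mul_sq_le_sq_mul_sq Finset.univ (fun j => M i j) x
    simpa [mulVec, dotProduct, ← sq] using this

lemma psd_conj {a b : ℕ} {M : Matrix (Fin a) (Fin a) ℝ} (hM : M.PosSemidef)
    (X : Matrix (Fin a) (Fin b) ℝ) : (Xᵀ * M * X).PosSemidef := by
  simpa [conjTranspose_eq_transpose_of_trivial] using hM.conjTranspose_mul_mul_same X

lemma psd_factor {a : ℕ} {M : Matrix (Fin a) (Fin a) ℝ} (hM : M.PosSemidef) :
    ∃ X : Matrix (Fin a) (Fin a) ℝ, M = Xᵀ * X := by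
  open scoped MatrixOrder in
  obtain ⟨X, hX⟩ := CStarAlgebra.nonneg_iff_eq_star_mul_self.1 hM.nonneg
  exact ⟨X, by rw [hX, star_eq_conjTranspose, conjTranspose_eq_transpose_of_trivial]⟩

lemma trace_sub_psd {a : ℕ} {M : Matrix (Fin a) (Fin a) ℝ} (hM : M.PosSemidef) :
    (M.trace • (1 : Matrix (Fin a) (Fin a) ℝ) - M).PosSemidef := by
  obtain ⟨X, rfl⟩ := psd_factor hM
  exact frob_sub_psd X

lemma trace_mul_nonneg {a : ℕ} {M S : Matrix (Fin a) (Fin a) ℝ} (hM : M.PosSemidef)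
    (hS : S.PosSemidef) : 0 ≤ (M * S).trace := by
  obtain ⟨X, rfl⟩ := psd_factor hM
  rw [Matrix.mul_assoc, trace_mul_comm]
  have := psd_conj hS Xᵀ
  rw [transpose_transpose] at this
  exact this.trace_nonneg

lemma specNorm_le_of_psd {a : ℕ} (D : Matrix (Fin a) (Fin a) ℝ) (c : ℝ) (hc : 0 ≤ c)
    (h1 : (c • (1 : Matrix (Fin a) (Fin a) ℝ) - D).PosSemidef)
    (h2 : (c • (1 : Matrix (Fin a) (Fin a) ℝ) + D).PosSemidef) : specNorm D ≤ c := by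
  refine le_of_forall_pos_le_add fun e he => ?_
  have hc' : 0 < c + e := by linarith
  have h0 : (e • (1 : Matrix (Fin a) (Fin a) ℝ)).PosSemidef := PosSemidef.one.smul he.le
  have h1' := h1.add h0
  have h2' := h2.add h0
  have hH : Dᵀ = D := by
    have := h2.isHermitian
    unfold Matrix.IsHermitian at this
    simpa [conjTranspose_eq_transpose_of_trivial] using this
  have key := (psd_conj h1' (c • (1 : Matrix (Fin a) (Fin a) ℝ) + D + e • 1)).add
    (psd_conj h2' (c • (1 : Matrix (Fin a) (Fin a) ℝ) - D + e • 1))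
  have heq : (c • (1 : Matrix (Fin a) (Fin a) ℝ) + D + e • 1)ᵀ *
      (c • (1 : Matrix (Fin a) (Fin a) ℝ) - D + e • 1) *
      (c • (1 : Matrix (Fin a) (Fin a) ℝ) + D + e • 1) +
      (c • (1 : Matrix (Fin a) (Fin a) ℝ) - D + e • 1)ᵀ *
      (c • (1 : Matrix (Fin a) (Fin a) ℝ) + D + e • 1) *
      (c • (1 : Matrix (Fin a) (Fin a) ℝ) - D + e • 1) =
      (2 * (c + e)) • ((c + e) ^ 2 • (1 : Matrix (Fin a) (Fin a) ℝ) - Dᵀ * D) := by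
    simp only [transpose_add, transpose_sub, transpose_smul, transpose_one, hH]
    simp only [Matrix.mul_add, Matrix.add_mul, Matrix.mul_sub, Matrix.sub_mul, Matrix.smul_mul,
      Matrix.mul_smul, Matrix.one_mul, Matrix.mul_one, Matrix.mul_assoc]
    module
  rw [heq] at key
  refine specNorm_le D _ hc'.le fun x => ?_
  have h := key.dotProduct_mulVec_nonneg x.ofLp
  simp only [sub_mulVec, smul_mulVec, one_mulVec, star_trivial, dotProduct_sub, dotProduct_smul,
      smul_eq_mul, ← mulVec_mulVec] at h
  rw [dotProduct_mulVec x.ofLp, vecMul_transpose, ← norm_vec_sq, ← norm_lin_sq] at h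
  have h' := nonneg_of_mul_nonneg_right h (by linarith)
  refine (pow_le_pow_iff_left₀ (norm_nonneg _) (by positivity) two_ne_zero).1 ?_
  rw [mul_pow]; linarith

/-! ### The operator `L` and summability -/

/-- `opL` as a linear map. -/
noncomputable def opLlin {d N : ℕ} (Pr : Matrix (Fin N) (Fin N) ℝ)
    (Γ : Fin N → Matrix (Fin d) (Fin d) ℝ) :
    (Fin N → Matrix (Fin d) (Fin d) ℝ) →ₗ[ℝ] (Fin N → Matrix (Fin d) (Fin d) ℝ) where
  toFun := opL Pr Γ
  map_add' V W := by
    funext i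
    simp [opL, opE, smul_add, Finset.sum_add_distrib, Matrix.mul_add, Matrix.add_mul]
  map_smul' c V := by
    funext i
    simp only [opL, opE, Pi.smul_apply, RingHom.id_apply]
    rw [← Matrix.smul_mul, ← Matrix.mul_smul, Finset.smul_sum]
    congr 3
    funext j
    rw [smul_comm]

lemma opL_cont {d N : ℕ} (Pr : Matrix (Fin N) (Fin N) ℝ)
    (Γ : Fin N → Matrix (Fin d) (Fin d) ℝ) : Continuous (opL Pr Γ) := by
  unfold opL opE
  fun_prop

lemma opL_vec {d N : ℕ} (Pr : Matrix (Fin N) (Fin N) ℝ)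
    (Γ : Fin N → Matrix (Fin d) (Fin d) ℝ) (V : Fin N → Matrix (Fin d) (Fin d) ℝ) :
    (fun q : Fin N × Fin d × Fin d => opL Pr Γ V q.1 q.2.1 q.2.2) =
      calA Pr Γ *ᵥ (fun q => V q.1 q.2.1 q.2.2) := by
  funext q
  obtain ⟨i, a, b⟩ := q
  rw [calA, ← mulVec_mulVec]
  have h : ((Pr ⊗ₖ (1 : Matrix (Fin d × Fin d) (Fin d × Fin d) ℝ)) *ᵥ
      (fun q : Fin N × Fin d × Fin d => V q.1 q.2.1 q.2.2)) =
      fun q => opE Pr V q.1 q.2.1 q.2.2 := by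
    funext q
    obtain ⟨i, a, b⟩ := q
    simp [mulVec, dotProduct, Fintype.sum_prod_type, kroneckerMap_apply, opE, Matrix.sum_apply,
      Matrix.one_apply, Prod.ext_iff, ite_and]
  convert_to _ = (_ *ᵥ ((Pr ⊗ₖ (1 : Matrix (Fin d × Fin d) (Fin d × Fin d) ℝ)) *ᵥ
      (fun q : Fin N × Fin d × Fin d => V q.1 q.2.1 q.2.2))) (i, a, b)
  rw [h]
  simp only [mulVec, dotProduct, Fintype.sum_prod_type, reindex_apply, submatrix_apply,
    Equiv.prodComm_symm, Equiv.prodComm_apply, Prod.swap_prod_mk, blockDiagonal_apply,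
    kroneckerMap_apply, transpose_apply, ite_mul, zero_mul, opL, mul_apply]
  rw [Finset.sum_eq_single i (by
    intro l _ hl
    simp [Ne.symm hl]) (by simp)]
  simp only [if_true, Finset.sum_mul]
  rw [Finset.sum_comm]
  refine Finset.sum_congr rfl fun c _ => Finset.sum_congr rfl fun e _ => ?_
  ring

lemma opL_iter_vec {d N : ℕ} (Pr : Matrix (Fin N) (Fin N) ℝ)
    (Γ : Fin N → Matrix (Fin d) (Fin d) ℝ) (V : Fin N → Matrix (Fin d) (Fin d) ℝ) (t : ℕ) :
    (fun q : Fin N × Fin d × Fin d => (opL Pr Γ)^[t] V q.1 q.2.1 q.2.2) =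
      (calA Pr Γ ^ t) *ᵥ (fun q => V q.1 q.2.1 q.2.2) := by
  induction t with
  | zero => simp
  | succ t ih =>
    rw [pow_succ', ← mulVec_mulVec, ← ih, ← opL_vec]
    simp only [Function.iterate_succ_apply']

section
attribute [local instance] Matrix.linftyOpNormedRing Matrix.linftyOpNormedAlgebra
  Matrix.linftyOpNormedAddCommGroup Matrix.linftyOpNormedSpace

lemma summable_of_spectralRadius {ι : Type*} [Fintype ι] [DecidableEq ι]
    (M : Matrix ι ι ℂ) (h : spectralRadius ℂ M < 1) : Summable fun t : ℕ => M ^ t := by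
  have : CompleteSpace (Matrix ι ι ℂ) := FiniteDimensional.complete ℂ _
  obtain ⟨r, hr1, hr2⟩ := ENNReal.lt_iff_exists_nnreal_btwn.1 h
  have hg := spectrum.pow_nnnorm_pow_one_div_tendsto_nhds_spectralRadius M
  have hev := hg.eventually_lt_const hr1
  have hr : (r : ℝ) < 1 := by exact_mod_cast hr2
  refine Summable.of_norm_bounded_eventually_nat (g := fun n => (r : ℝ) ^ n)
    (summable_geometric_of_lt_one r.2 hr) ?_
  filter_upwards [hev, eventually_gt_atTop 0] with n hn hn0
  have h1 := ENNReal.rpow_le_rpow hn.le (z := (n : ℝ)) (by positivity)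
  rw [← ENNReal.rpow_mul, one_div, inv_mul_cancel₀ (by positivity), ENNReal.rpow_one,
    ENNReal.rpow_natCast] at h1
  have h2 : ‖M ^ n‖₊ ≤ r ^ n := by exact_mod_cast h1
  exact_mod_cast h2

end

lemma summable_calA {d k N : ℕ} (Pr : Matrix (Fin N) (Fin N) ℝ)
    (A : Fin N → Matrix (Fin d) (Fin d) ℝ) (B : Fin N → Matrix (Fin d) (Fin k) ℝ)
    (K : Fin N → Matrix (Fin k) (Fin d) ℝ) (hK : MSS Pr A B K) :
    Summable fun t : ℕ => calA Pr (Gam A B K) ^ t := by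
  have h1 : spectralRadius ℂ ((calA Pr (Gam A B K)).map (algebraMap ℝ ℂ)) < 1 := by
    unfold MSS at hK
    convert hK
  have h := summable_of_spectralRadius _ h1
  have hre : Continuous fun M : Matrix (Fin N × Fin d × Fin d) (Fin N × Fin d × Fin d) ℂ =>
      M.map Complex.re := by fun_prop
  let f : Matrix (Fin N × Fin d × Fin d) (Fin N × Fin d × Fin d) ℂ →+
      Matrix (Fin N × Fin d × Fin d) (Fin N × Fin d × Fin d) ℝ :=
    { toFun := fun M => M.map Complex.re
      map_zero' := by ext; simp
      map_add' := fun M N => by ext; simp }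
  have h' := h.map f hre
  convert h' using 1
  funext t
  show _ = ((calA Pr (Gam A B K)).map (algebraMap ℝ ℂ) ^ t).map Complex.re
  rw [← Matrix.map_pow]
  ext; simp

lemma summable_opL {d k N : ℕ} (Pr : Matrix (Fin N) (Fin N) ℝ)
    (A : Fin N → Matrix (Fin d) (Fin d) ℝ) (B : Fin N → Matrix (Fin d) (Fin k) ℝ)
    (K : Fin N → Matrix (Fin k) (Fin d) ℝ) (hK : MSS Pr A B K)
    (V : Fin N → Matrix (Fin d) (Fin d) ℝ) :
    Summable fun t : ℕ => (opL Pr (Gam A B K))^[t] V := by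
  have h := summable_calA Pr A B K hK
  rw [Pi.summable]
  intro i
  refine Pi.summable.2 fun a => Pi.summable.2 fun b => ?_
  let f : Matrix (Fin N × Fin d × Fin d) (Fin N × Fin d × Fin d) ℝ →+ ℝ :=
    { toFun := fun M => (M *ᵥ (fun q => V q.1 q.2.1 q.2.2)) (i, a, b)
      map_zero' := by simp
      map_add' := fun M N => by simp [add_mulVec] }
  have hf : Continuous f := by
    show Continuous fun M : Matrix (Fin N × Fin d × Fin d) (Fin N × Fin d × Fin d) ℝ =>
      (M *ᵥ (fun q => V q.1 q.2.1 q.2.2)) (i, a, b)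
    fun_prop
  have h' := h.map f hf
  convert h' using 1
  funext t
  exact congrFun (opL_iter_vec Pr (Gam A B K) V t) (i, a, b)

lemma tsum_opL {d k N : ℕ} (Pr : Matrix (Fin N) (Fin N) ℝ)
    (A : Fin N → Matrix (Fin d) (Fin d) ℝ) (B : Fin N → Matrix (Fin d) (Fin k) ℝ)
    (K : Fin N → Matrix (Fin k) (Fin d) ℝ) (hK : MSS Pr A B K)
    (V : Fin N → Matrix (Fin d) (Fin d) ℝ) :
    ∑' t : ℕ, (opL Pr (Gam A B K))^[t] V =
      V + opL Pr (Gam A B K) (∑' t : ℕ, (opL Pr (Gam A B K))^[t] V) := by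
  have h := summable_opL Pr A B K hK V
  conv_lhs => rw [h.tsum_eq_zero_add]
  have := h.map_tsum (opLlin Pr (Gam A B K)) (opL_cont Pr (Gam A B K))
  simp only [Function.iterate_succ_apply', Function.iterate_zero_apply]
  congr 1
  exact this.symm

lemma opL_psd {d N : ℕ} (Pr : Matrix (Fin N) (Fin N) ℝ) (hPr : ∀ i j, 0 ≤ Pr i j)
    (Γ : Fin N → Matrix (Fin d) (Fin d) ℝ) (V : Fin N → Matrix (Fin d) (Fin d) ℝ)
    (hV : ∀ i, (V i).PosSemidef) (i : Fin N) : (opL Pr Γ V i).PosSemidef :=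
  psd_conj (posSemidef_sum _ fun j _ => (hV j).smul (hPr i j)) _

lemma psd_of_fix {d k N : ℕ} (Pr : Matrix (Fin N) (Fin N) ℝ) (hPr : ∀ i j, 0 ≤ Pr i j)
    (A : Fin N → Matrix (Fin d) (Fin d) ℝ) (B : Fin N → Matrix (Fin d) (Fin k) ℝ)
    (K : Fin N → Matrix (Fin k) (Fin d) ℝ) (hK : MSS Pr A B K)
    (V F : Fin N → Matrix (Fin d) (Fin d) ℝ)
    (hV : V = F + opL Pr (Gam A B K) V) (hF : ∀ i, (F i).PosSemidef) (i : Fin N) :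
    (V i).PosSemidef := by
  have hstep : ∀ t : ℕ, ∀ i, (V i - (opL Pr (Gam A B K))^[t] V i).PosSemidef := by
    intro t
    induction t with
    | zero => intro i; simpa using PosSemidef.zero
    | succ t ih =>
      intro i
      have h := opL_psd Pr hPr (Gam A B K) (V - (opL Pr (Gam A B K))^[t] V) ih i
      have hl : opL Pr (Gam A B K) (V - (opL Pr (Gam A B K))^[t] V) =
          opL Pr (Gam A B K) V - opL Pr (Gam A B K) ((opL Pr (Gam A B K))^[t] V) :=
        map_sub (opLlin Pr (Gam A B K)) _ _
      rw [hl] at h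
      have h2 := (hF i).add h
      rw [Function.iterate_succ_apply']
      convert h2 using 1
      have hVi : V i = F i + opL Pr (Gam A B K) V i := congrFun hV i
      rw [Pi.sub_apply, ← add_sub_assoc, ← hVi]
  have ht := (summable_opL Pr A B K hK V).tendsto_atTop_zero
  have hlim : Tendsto (fun t : ℕ => V i - (opL Pr (Gam A B K))^[t] V i) atTop (𝓝 (V i)) := by
    have := (tendsto_pi_nhds.1 ht i).const_sub (V i)
    simpa using this
  have hH : (V i)ᵀ = V i := by
    refine tendsto_nhds_unique
      (((continuous_id.matrix_transpose).tendsto (V i)).comp hlim) (hlim.congr fun t => ?_)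
    have := (hstep t i).isHermitian
    unfold Matrix.IsHermitian at this
    rw [conjTranspose_eq_transpose_of_trivial] at this
    exact this.symm
  refine .of_dotProduct_mulVec_nonneg ?_ fun x => ?_
  · unfold Matrix.IsHermitian
    rw [conjTranspose_eq_transpose_of_trivial, hH]
  · have hc : Continuous fun M : Matrix (Fin d) (Fin d) ℝ => star x ⬝ᵥ M *ᵥ x := by fun_prop
    exact ge_of_tendsto' ((hc.tendsto _).comp hlim) fun t =>
      (hstep t i).dotProduct_mulVec_nonneg x

lemma PK_lyap {d k N : ℕ} (Pr : Matrix (Fin N) (Fin N) ℝ)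
    (A : Fin N → Matrix (Fin d) (Fin d) ℝ) (B : Fin N → Matrix (Fin d) (Fin k) ℝ)
    (Q : Fin N → Matrix (Fin d) (Fin d) ℝ) (R : Fin N → Matrix (Fin k) (Fin k) ℝ)
    (K : Fin N → Matrix (Fin k) (Fin d) ℝ) (hK : MSS Pr A B K) :
    IsLyap Pr A B Q R K (PK Pr A B Q R K) := by
  have h : ∃ P, IsLyap Pr A B Q R K P :=
    ⟨_, fun i => congrFun (tsum_opL Pr A B K hK (fun i => Q i + (K i)ᵀ * R i * K i)) i⟩
  unfold PK
  rw [dif_pos h]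
  exact h.choose_spec

/-! ### Main estimates -/

lemma ciInf_pos_fin {N : ℕ} (hN : 0 < N) (f : Fin N → ℝ) (hf : ∀ i, 0 < f i) : 0 < ⨅ i, f i := by
  have : Nonempty (Fin N) := ⟨⟨0, hN⟩⟩
  obtain ⟨i, hi⟩ := exists_eq_ciInf_of_finite (f := f)
  rw [← hi]; exact hf i

lemma PK_psd {d k N : ℕ} (Pr : Matrix (Fin N) (Fin N) ℝ) (hPr : ∀ i j, 0 ≤ Pr i j)
    (A : Fin N → Matrix (Fin d) (Fin d) ℝ) (B : Fin N → Matrix (Fin d) (Fin k) ℝ)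
    (Q : Fin N → Matrix (Fin d) (Fin d) ℝ) (hQ : ∀ i, (Q i).PosDef)
    (R : Fin N → Matrix (Fin k) (Fin k) ℝ) (hR : ∀ i, (R i).PosDef)
    (K : Fin N → Matrix (Fin k) (Fin d) ℝ) (hK : MSS Pr A B K) (i : Fin N) :
    (PK Pr A B Q R K i).PosSemidef :=
  psd_of_fix Pr hPr A B K hK _ (fun i => Q i + (K i)ᵀ * R i * K i)
    (funext fun i => PK_lyap Pr A B Q R K hK i)
    (fun i => (hQ i).posSemidef.add (psd_conj (hR i).posSemidef _)) i

/-- `P_i ⪯ (C/μ) I`. -/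
lemma PK_le_cost {d N : ℕ} (hd : 0 < d) (hN : 0 < N)
    (P : Fin N → Matrix (Fin d) (Fin d) ℝ) (hP : ∀ i, (P i).PosSemidef)
    (piv : Fin N → ℝ) (hpiv : ∀ i, 0 < piv i)
    (Sg : Matrix (Fin d) (Fin d) ℝ) (hSg : Sg.PosDef) (i : Fin N) :
    (((∑ i, piv i * (P i * Sg).trace) / mu piv Sg) • (1 : Matrix (Fin d) (Fin d) ℝ)
      - P i).PosSemidef := by
  have hs := sigmaMin_pos hd Sg hSg
  have hm := ciInf_pos_fin hN piv hpiv
  have hmu : 0 < mu piv Sg := mul_pos hm hs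
  have hj : ∀ j, sigmaMin Sg * (P j).trace ≤ (P j * Sg).trace := by
    intro j
    have h := trace_mul_nonneg (hP j) (psd_sub_sigmaMin Sg hSg.posSemidef _ le_rfl)
    simp only [Matrix.mul_sub, Matrix.mul_smul, Matrix.mul_one, trace_sub, trace_smul,
      smul_eq_mul] at h
    linarith
  have hj0 : ∀ j, 0 ≤ (P j * Sg).trace := fun j => trace_mul_nonneg (hP j) hSg.posSemidef
  have h1 : mu piv Sg * (P i).trace ≤ ∑ i, piv i * (P i * Sg).trace := by
    calc mu piv Sg * (P i).trace = (⨅ i, piv i) * (sigmaMin Sg * (P i).trace) := by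
          unfold mu; ring
      _ ≤ piv i * (P i * Sg).trace := by
          have hle : (⨅ i, piv i) ≤ piv i := ciInf_le (Set.finite_range _).bddBelow i
          exact mul_le_mul hle (hj i) (mul_nonneg hs.le (hP i).trace_nonneg) (hpiv i).le
      _ ≤ _ := Finset.single_le_sum (f := fun i => piv i * (P i * Sg).trace)
          (fun j _ => mul_nonneg (hpiv j).le (hj0 j)) (Finset.mem_univ i)
  have h2 : (P i).trace ≤ (∑ i, piv i * (P i * Sg).trace) / mu piv Sg := by
    rw [le_div_iff₀ hmu]; linarith
  have h3 := (trace_sub_psd (hP i)).add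
    ((PosSemidef.one (n := Fin d) (R := ℝ)).smul (sub_nonneg.2 h2))
  convert h3 using 1
  module

/-- The one-step bound. -/
lemma step_psd {d k : ℕ} (A : Matrix (Fin d) (Fin d) ℝ) (B : Matrix (Fin d) (Fin k) ℝ)
    (Q P M : Matrix (Fin d) (Fin d) ℝ) (R : Matrix (Fin k) (Fin k) ℝ)
    (K E : Matrix (Fin k) (Fin d) ℝ) (lam r b c x : ℝ)
    (hMT : Mᵀ = M) (hRT : Rᵀ = R) (hx : 0 ≤ x) (hr : 0 ≤ r) (hc : 0 ≤ c)
    (hxl : (x + 1) * lam = (1 + b ^ 2) * c + r)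
    (hM : M.PosSemidef) (hR : R.PosSemidef)
    (hQl : (Q - lam • (1 : Matrix (Fin d) (Fin d) ℝ)).PosSemidef)
    (hRr : (r • (1 : Matrix (Fin k) (Fin k) ℝ) - R).PosSemidef)
    (hB : (b ^ 2 • (1 : Matrix (Fin k) (Fin k) ℝ) - Bᵀ * B).PosSemidef)
    (hPc : (c • (1 : Matrix (Fin d) (Fin d) ℝ) - P).PosSemidef)
    (hMc : (c • (1 : Matrix (Fin d) (Fin d) ℝ) - M).PosSemidef)
    (hE : ((1 : Matrix (Fin d) (Fin d) ℝ) - Eᵀ * E).PosSemidef)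
    (hP : P = Q + Kᵀ * R * K + (A - B * K)ᵀ * M * (A - B * K)) :
    (x • (Q + Kᵀ * R * K) - (Eᵀ * ((R + Bᵀ * M * B) * K - Bᵀ * M * A) +
      ((R + Bᵀ * M * B) * K - Bᵀ * M * A)ᵀ * E)).PosSemidef := by
  have t1 := psd_conj hR (E - K)
  have t2 := psd_conj hM (B * E + (A - B * K))
  have t3 := hQl.smul (show 0 ≤ x + 1 by linarith)
  have t5 := (hE.smul hr).add (psd_conj hRr E)
  have t6 := ((psd_conj hMc (B * E)).add ((psd_conj hB E).smul hc)).add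
    (hE.smul (show 0 ≤ c * b ^ 2 by positivity))
  have t7 := (psd_conj hR K).smul hx
  have T := (((((t1.add t2).add t3).add hPc).add t5).add t6).add t7
  convert T using 1
  rw [smul_sub (x + 1), smul_smul, hxl, hP]
  simp only [transpose_add, transpose_sub, transpose_mul, transpose_transpose, hMT, hRT,
    Matrix.mul_add, Matrix.add_mul, Matrix.mul_sub, Matrix.sub_mul, Matrix.smul_mul,
      Matrix.mul_smul, Matrix.one_mul, Matrix.mul_one, Matrix.mul_assoc, smul_sub, smul_add]
  module

lemma PKd_neg {d k N : ℕ} (Pr : Matrix (Fin N) (Fin N) ℝ)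
    (Γ : Fin N → Matrix (Fin d) (Fin d) ℝ)
    (Lk E : Fin N → Matrix (Fin k) (Fin d) ℝ) : PKd Pr Γ Lk (-E) = -PKd Pr Γ Lk E := by
  unfold PKd
  rw [← tsum_neg]
  congr 1
  funext t
  have h0 : (fun i => ((-E) i)ᵀ * Lk i + (Lk i)ᵀ * (-E) i) =
      -(fun i => (E i)ᵀ * Lk i + (Lk i)ᵀ * E i) := by
    funext i
    simp only [Pi.neg_apply, transpose_neg, Matrix.neg_mul, Matrix.mul_neg]
    abel
  rw [h0]
  have : ∀ (t : ℕ) V, (opL Pr Γ)^[t] V = ((opLlin Pr Γ) ^ t) V := by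
    intro t V
    rw [Module.End.pow_apply]
    rfl
  rw [this, this, map_neg]

lemma spec_le_maxNorm {a b N : ℕ} (V : Fin N → Matrix (Fin a) (Fin b) ℝ) (i : Fin N) :
    specNorm (V i) ≤ maxNorm V :=
  le_ciSup (f := fun i => specNorm (V i)) (Set.finite_range _).bddAbove i

/-- Everything for a fixed direction. -/
lemma main_psd
    (d k N : ℕ) (hd : 0 < d) (hN : 0 < N)
    (A : Fin N → Matrix (Fin d) (Fin d) ℝ) (B : Fin N → Matrix (Fin d) (Fin k) ℝ)
    (Pr : Matrix (Fin N) (Fin N) ℝ)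
    (hPr : ∀ i j, 0 ≤ Pr i j) (hPrSum : ∀ i, ∑ j, Pr i j = 1)
    (piv : Fin N → ℝ) (hpiv : ∀ i, 0 < piv i)
    (Sg : Matrix (Fin d) (Fin d) ℝ) (hSg : Sg.PosDef)
    (Q : Fin N → Matrix (Fin d) (Fin d) ℝ) (hQ : ∀ i, (Q i).PosDef)
    (R : Fin N → Matrix (Fin k) (Fin k) ℝ) (hR : ∀ i, (R i).PosDef)
    (K : Fin N → Matrix (Fin k) (Fin d) ℝ) (hK : MSS Pr A B K) :
    0 ≤ xi B R Q piv Sg (cost Pr A B Q R piv Sg K) ∧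
    ∀ E : Fin N → Matrix (Fin k) (Fin d) ℝ, norm2sq E = 1 →
    (∀ i, (xi B R Q piv Sg (cost Pr A B Q R piv Sg K) • PK Pr A B Q R K i
        - PKd Pr (Gam A B K) (LK Pr A B Q R K) E i).PosSemidef) := by
  have hP := PK_psd Pr hPr A B Q hQ R hR K hK
  have hLy := PK_lyap Pr A B Q R K hK
  have hPc := PK_le_cost hd hN _ hP piv hpiv Sg hSg
  change ∀ i, ((cost Pr A B Q R piv Sg K / mu piv Sg) • (1 : Matrix (Fin d) (Fin d) ℝ) -
    PK Pr A B Q R K i).PosSemidef at hPc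
  set c := cost Pr A B Q R piv Sg K / mu piv Sg with hcdef
  set P := PK Pr A B Q R K with hPdef
  have hlam : 0 < lamMin Q := ciInf_pos_fin hN _ fun i => sigmaMin_pos hd _ (hQ i)
  have hQl : ∀ i, (Q i - lamMin Q • (1 : Matrix (Fin d) (Fin d) ℝ)).PosSemidef := fun i =>
    psd_sub_sigmaMin _ (hQ i).posSemidef _ (ciInf_le (Set.finite_range _).bddBelow i)
  have hr : 0 ≤ maxNorm R := Real.iSup_nonneg fun _ => specNorm_nonneg _
  have hMpsd : ∀ i, (opE Pr P i).PosSemidef := fun i =>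
    posSemidef_sum _ fun j _ => (hP j).smul (hPr i j)
  have hcl : lamMin Q ≤ c := by
    let i0 : Fin N := ⟨0, hN⟩
    let j0 : Fin d := ⟨0, hd⟩
    have h := ((hPc i0).add (hQl i0)).add
      ((psd_conj (hR i0).posSemidef (K i0)).add (psd_conj (hMpsd i0) (Gam A B K i0)))
    have h2 : c • (1 : Matrix (Fin d) (Fin d) ℝ) - P i0 + (Q i0 - lamMin Q • 1) +
        ((K i0)ᵀ * R i0 * K i0 + (Gam A B K i0)ᵀ * opE Pr P i0 * Gam A B K i0) =
        (c - lamMin Q) • 1 := by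
      rw [hLy i0]
      module
    rw [h2] at h
    have := h.diag_nonneg (i := j0)
    simpa using this
  have hc : 0 ≤ c := hlam.le.trans hcl
  have hxl : (xi B R Q piv Sg (cost Pr A B Q R piv Sg K) + 1) * lamMin Q =
      (1 + maxNorm B ^ 2) * c + maxNorm R := by
    unfold xi
    rw [hcdef]
    field_simp
    ring
  set x := xi B R Q piv Sg (cost Pr A B Q R piv Sg K) with hxdef
  have hx : 0 ≤ x := by
    have h1 : lamMin Q ≤ (x + 1) * lamMin Q := by
      rw [hxl]
      nlinarith [mul_nonneg (sq_nonneg (maxNorm B)) hc]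
    nlinarith
  refine ⟨hx, fun E hE => ?_⟩
  have hMc : ∀ i, (c • (1 : Matrix (Fin d) (Fin d) ℝ) - opE Pr P i).PosSemidef := by
    intro i
    have h := posSemidef_sum (Finset.univ : Finset (Fin N))
      (x := fun j => Pr i j • (c • (1 : Matrix (Fin d) (Fin d) ℝ) - P j))
      fun j _ => (hPc j).smul (hPr i j)
    simp only [smul_sub, Finset.sum_sub_distrib, ← Finset.sum_smul, hPrSum, one_smul] at h
    exact h
  have hEi : ∀ i, ((1 : Matrix (Fin d) (Fin d) ℝ) - (E i)ᵀ * E i).PosSemidef := by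
    intro i
    have h1 : ((E i)ᵀ * E i).trace ≤ 1 := by
      rw [← hE]
      refine Finset.single_le_sum (f := fun i => ((E i)ᵀ * E i).trace) (fun j _ => ?_)
        (Finset.mem_univ i)
      have := (posSemidef_conjTranspose_mul_self (E j)).trace_nonneg
      rwa [conjTranspose_eq_transpose_of_trivial] at this
    have h2 := (frob_sub_psd (E i)).add
      ((PosSemidef.one (n := Fin d) (R := ℝ)).smul (sub_nonneg.2 h1))
    convert h2 using 1
    module
  have hstep : ∀ i, (x • (Q i + (K i)ᵀ * R i * K i) - ((E i)ᵀ * LK Pr A B Q R K i +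
      (LK Pr A B Q R K i)ᵀ * E i)).PosSemidef := by
    intro i
    refine step_psd (A i) (B i) (Q i) (P i) (opE Pr P i) (R i) (K i) (E i) (lamMin Q) (maxNorm R)
      (maxNorm B) c x ?_ ?_ hx hr hc hxl (hMpsd i) (hR i).posSemidef (hQl i) ?_ ?_ (hPc i) (hMc i)
      (hEi i) (hLy i)
    · have := (hMpsd i).isHermitian
      unfold Matrix.IsHermitian at this
      rwa [conjTranspose_eq_transpose_of_trivial] at this
    · have := (hR i).isHermitian
      unfold Matrix.IsHermitian at this
      rwa [conjTranspose_eq_transpose_of_trivial] at this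
    · exact spec_sub_psd _ (hR i).isHermitian _ (spec_le_maxNorm R i)
    · exact spec_sq_sub_psd _ _ (spec_le_maxNorm B i)
  refine psd_of_fix Pr hPr A B K hK
    (fun i => x • P i - PKd Pr (Gam A B K) (LK Pr A B Q R K) E i) _ ?_ hstep
  have hD := tsum_opL Pr A B K hK (fun i => (E i)ᵀ * LK Pr A B Q R K i +
      (LK Pr A B Q R K i)ᵀ * E i)
  change PKd Pr (Gam A B K) (LK Pr A B Q R K) E = _ + opL Pr (Gam A B K)
    (PKd Pr (Gam A B K) (LK Pr A B Q R K) E) at hD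
  set D := PKd Pr (Gam A B K) (LK Pr A B Q R K) E
  have hPf : P = (fun i => Q i + (K i)ᵀ * R i * K i) + opL Pr (Gam A B K) P :=
    funext fun i => hLy i
  change x • P - D = _ + opL Pr (Gam A B K) (x • P - D)
  have hl : opL Pr (Gam A B K) (x • P - D) =
      x • opL Pr (Gam A B K) P - opL Pr (Gam A B K) D := by
    have h1 := map_sub (opLlin Pr (Gam A B K)) (x • P) D
    rw [map_smul] at h1
    exact h1
  rw [hl]
  funext i
  have e1 := congrFun hPf i
  have e2 := congrFun hD i
  simp only [Pi.add_apply, Pi.sub_apply, Pi.smul_apply] at e1 e2 ⊢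
  generalize opL Pr (Gam A B K) P i = U at *
  generalize opL Pr (Gam A B K) D i = W at *
  rw [e1, e2]
  module

/-- derivative bound for the value function. -/
theorem value_function_derivative_bound
    (d k N : ℕ) (hd : 0 < d) (hk : 0 < k) (hN : 0 < N)
    (A : Fin N → Matrix (Fin d) (Fin d) ℝ) (B : Fin N → Matrix (Fin d) (Fin k) ℝ)
    (Pr : Matrix (Fin N) (Fin N) ℝ)
    (hPr : ∀ i j, 0 ≤ Pr i j) (hPrSum : ∀ i, ∑ j, Pr i j = 1)
    (piv : Fin N → ℝ) (hpiv : ∀ i, 0 < piv i) (hpivSum : ∑ i, piv i = 1)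
    (Sg : Matrix (Fin d) (Fin d) ℝ) (hSg : Sg.PosDef)
    (Q : Fin N → Matrix (Fin d) (Fin d) ℝ) (hQ : ∀ i, (Q i).PosDef)
    (R : Fin N → Matrix (Fin k) (Fin k) ℝ) (hR : ∀ i, (R i).PosDef)
    (K : Fin N → Matrix (Fin k) (Fin d) ℝ) (hK : MSS Pr A B K)
    (E : Fin N → Matrix (Fin k) (Fin d) ℝ) (hE : Real.sqrt (norm2sq E) = 1) :
    (∀ i, (xi B R Q piv Sg (cost Pr A B Q R piv Sg K) • PK Pr A B Q R K i
        - PKd Pr (Gam A B K) (LK Pr A B Q R K) E i).PosSemidef) ∧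
    (⨆ i, specNorm (PKd Pr (Gam A B K) (LK Pr A B Q R K) E i))
      ≤ xi B R Q piv Sg (cost Pr A B Q R piv Sg K) * ⨆ i, specNorm (PK Pr A B Q R K i) := by
  have hE1 : norm2sq E = 1 := by
    have := hE
    rwa [Real.sqrt_eq_one] at this
  obtain ⟨hx, hmain⟩ := main_psd d k N hd hN A B Pr hPr hPrSum piv hpiv Sg hSg Q hQ R hR K hK
  have hpos := hmain E hE1
  have hneg := hmain (-E) (by simpa [norm2sq] using hE1)
  have hP := PK_psd Pr hPr A B Q hQ R hR K hK
  refine ⟨hpos, ?_⟩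
  rw [PKd_neg] at hneg
  set x := xi B R Q piv Sg (cost Pr A B Q R piv Sg K)
  have hM0 : 0 ≤ ⨆ i, specNorm (PK Pr A B Q R K i) := Real.iSup_nonneg fun _ => specNorm_nonneg _
  refine Real.iSup_le (fun i => ?_) (mul_nonneg hx hM0)
  have h1 := (spec_sub_psd _ (hP i).isHermitian _
    (spec_le_maxNorm (PK Pr A B Q R K) i)).smul hx
  change (x • ((⨆ i, specNorm (PK Pr A B Q R K i)) • (1 : Matrix (Fin d) (Fin d) ℝ) -
    PK Pr A B Q R K i)).PosSemidef at h1
  refine specNorm_le_of_psd _ _ (mul_nonneg hx hM0) ?_ ?_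
  · convert h1.add (hpos i) using 1
    module
  · convert h1.add (hneg i) using 1
    simp only [Pi.neg_apply]
    module

end MJLS
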